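/- Let d ≥ 2 and n ≥ 1 be integers and let f_0, …, f_{n−1} be monic polynomials over ℂ of degree d. If the composition f_{n−1} ∘ ⋯ ∘ f_0 is affinely conjugate to T_{dⁿ} or to −T_{dⁿ}, then there exist complex numbers c_j and ℓ_j (0 ≤ j ≤ n−1, indices modulo n) such that f_j(x) = D_d(x − c_j, ℓ_j) + c_{j+1} and ℓ_{j+1} = ℓ_j^d for all j, and moreover ℓ_0^{dⁿ−1} = 1. -/

import Mathlib

open Polynomial

noncomputable section

/-- The Chebyshev polynomial `T_d` of the paper, `T_d(x) = D_d(x, 1)`. -/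
def ChebT (d : ℕ) : Polynomial ℂ := dickson 1 1 d

/-- `compChain f n = f_{n-1} ∘ ⋯ ∘ f_0` (and `compChain f 0 = X`, the identity). -/
def compChain (f : ℕ → Polynomial ℂ) : ℕ → Polynomial ℂ
  | 0 => X
  | k + 1 => (f k).comp (compChain f k)

/-- `f` is affinely conjugate to `g`: `f = L⁻¹ ∘ g ∘ L` for an affine map `L(x) = ux + v`, `u ≠ 0`. -/
def AffConj (f g : Polynomial ℂ) : Prop :=
  ∃ u v : ℂ, u ≠ 0 ∧ f = (C u⁻¹ * (X - C v)).comp (g.comp (C u * X + C v))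

theorem dickson_one_eval_add {R : Type*} [CommRing R] (x y : R) (n : ℕ) :
    (dickson 1 (x * y) n).eval (x + y) = x ^ n + y ^ n := by
  induction n using Nat.twoStepInduction with
  | zero => simp [dickson_zero]; norm_num
  | one => simp
  | more n ih₀ ih₁ =>
    rw [dickson_add_two]
    simp only [eval_sub, eval_mul, eval_X, eval_C, ih₀, ih₁]
    ring

theorem Complex.exists_add_eq_mul_eq (z a : ℂ) : ∃ x y : ℂ, x + y = z ∧ x * y = a := by
  obtain ⟨s, hs⟩ := IsAlgClosed.exists_pow_nat_eq (z ^ 2 - 4 * a) (n := 2) (by norm_num)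
  exact ⟨(z + s) / 2, (z - s) / 2, by ring, by linear_combination -hs / 4⟩

theorem dickson_one_mul (a : ℂ) (m n : ℕ) :
    dickson 1 a (m * n) = (dickson 1 (a ^ n) m).comp (dickson 1 a n) := by
  refine Polynomial.funext fun z => ?_
  obtain ⟨x, y, rfl, rfl⟩ := Complex.exists_add_eq_mul_eq z a
  rw [eval_comp, dickson_one_eval_add, dickson_one_eval_add, mul_pow, dickson_one_eval_add,
    ← pow_mul, ← pow_mul, mul_comm m n]

theorem dickson_one_eval_mul (u a z : ℂ) (n : ℕ) :
    (dickson 1 (u ^ 2 * a) n).eval (u * z) = u ^ n * (dickson 1 a n).eval z := by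
  obtain ⟨x, y, rfl, rfl⟩ := Complex.exists_add_eq_mul_eq z a
  rw [dickson_one_eval_add, show u ^ 2 * (x * y) = u * x * (u * y) by ring, mul_add,
    dickson_one_eval_add]
  ring

theorem dickson_one_monic_natDegree {R : Type*} [CommRing R] [Nontrivial R] (a : R) (n : ℕ) :
    (dickson 1 a (n + 1)).Monic ∧ (dickson 1 a (n + 1)).natDegree = n + 1 := by
  induction n using Nat.strong_induction_on with
  | _ n ih =>
    rcases n with _ | n
    · simp [monic_X]
    obtain ⟨hm, hd⟩ := ih n (by omega)
    have hle : (dickson 1 a n).natDegree ≤ n := by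
      rcases n with _ | n
      · have h : dickson 1 a 0 = C (2 : R) := by
          rw [dickson_zero, C_ofNat]; norm_num
        rw [h, natDegree_C]
      · exact (ih n (by omega)).2.le
    have hX : (X * dickson 1 a (n + 1)).natDegree = n + 2 := by
      rw [monic_X.natDegree_mul hm, natDegree_X, hd]; ring
    have hlt : (C a * dickson 1 a n).degree < (X * dickson 1 a (n + 1)).degree := by
      rw [degree_eq_natDegree (monic_X.mul hm).ne_zero, hX]
      refine degree_le_natDegree.trans_lt ?_
      have := natDegree_C_mul_le a (dickson 1 a n)
      exact_mod_cast (show (C a * dickson 1 a n).natDegree < n + 2 by omega)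
    rw [dickson_add_two]
    refine ⟨(monic_X.mul hm).sub_of_left hlt, ?_⟩
    rw [natDegree_eq_of_degree_eq (degree_sub_eq_left_of_degree_lt hlt), hX]

theorem dickson_one_monic {R : Type*} [CommRing R] [Nontrivial R] (a : R) {n : ℕ} (hn : n ≠ 0) :
    (dickson 1 a n).Monic := by
  obtain ⟨n, rfl⟩ := Nat.exists_eq_succ_of_ne_zero hn
  exact (dickson_one_monic_natDegree a n).1

theorem natDegree_dickson_one {R : Type*} [CommRing R] [Nontrivial R] (a : R) {n : ℕ}
    (hn : n ≠ 0) : (dickson 1 a n).natDegree = n := by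
  obtain ⟨n, rfl⟩ := Nat.exists_eq_succ_of_ne_zero hn
  exact (dickson_one_monic_natDegree a n).2

theorem Polynomial.Monic.natDegree_comp_sub_pow_le {K : Type*} [Field K] {f : K[X]}
    (hf : f.Monic) (g : K[X]) :
    (f.comp g - g ^ f.natDegree).natDegree ≤ (f.natDegree - 1) * g.natDegree := by
  have h : f.comp g - g ^ f.natDegree = (f - X ^ f.natDegree).comp g := by simp
  rw [h, natDegree_comp]
  refine Nat.mul_le_mul_right _ ?_
  have hlt : (f - X ^ f.natDegree).degree < f.degree :=
    degree_sub_lt_left (by rw [degree_X_pow, degree_eq_natDegree hf.ne_zero]) hf.ne_zero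
      (by rw [hf.leadingCoeff, leadingCoeff_X_pow])
  by_cases h₀ : f - X ^ f.natDegree = 0
  · simp [h₀]
  · have := natDegree_lt_natDegree h₀ hlt
    omega

/-- In characteristic zero, the right factors of two decompositions of the same polynomial into
monic factors of the same degrees differ by a constant. -/
theorem Polynomial.Monic.natDegree_sub_eq_zero_of_comp_eq_comp {K : Type*} [Field K] [CharZero K]
    {f g h k : K[X]} (hf : f.Monic) (hg : g.Monic) (hh : h.Monic) (hk : k.Monic)
    (hfh : f.natDegree = h.natDegree) (hgk : g.natDegree = k.natDegree) (hf₀ : f.natDegree ≠ 0)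
    (heq : f.comp g = h.comp k) : (g - k).natDegree = 0 := by
  by_contra hne
  set m := f.natDegree with hm
  set e := g.natDegree with he
  set s := ∑ i ∈ Finset.range m, g ^ i * k ^ (m - 1 - i) with hs
  have hterm : ∀ i ∈ Finset.range m, (g ^ i * k ^ (m - 1 - i)).natDegree = (m - 1) * e := by
    intro i hi
    have hi' := Finset.mem_range.1 hi
    rw [(hg.pow i).natDegree_mul (hk.pow _), hg.natDegree_pow, hk.natDegree_pow, ← hgk, ← add_mul]
    congr 1
    omega
  have hcoeff : s.coeff ((m - 1) * e) = m := by
    rw [hs, finsetSum_coeff, Finset.sum_congr rfl (g := fun _ => (1 : K))]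
    · simp
    · intro i hi
      rw [← hterm i hi]
      exact ((hg.pow i).mul (hk.pow _)).coeff_natDegree
  have hcoeff₀ : s.coeff ((m - 1) * e) ≠ 0 := by
    rw [hcoeff]
    exact_mod_cast hf₀
  have hs₀ : s ≠ 0 := fun h0 => hcoeff₀ (by rw [h0, coeff_zero])
  have hgk₀ : g - k ≠ 0 := fun h0 => hne (by rw [h0, natDegree_zero])
  have hprod : s * (g - k) = g ^ m - k ^ m := Commute.geom_sum₂_mul (Commute.all g k) m
  have hlow : g ^ m - k ^ m = (h.comp k - k ^ m) - (f.comp g - g ^ m) := by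
    rw [heq]; ring
  have hle : (s * (g - k)).natDegree ≤ (m - 1) * e := by
    rw [hprod, hlow]
    refine (natDegree_sub_le _ _).trans (max_le ?_ ?_)
    · have := hh.natDegree_comp_sub_pow_le k
      rwa [← hfh, ← hgk] at this
    · exact hf.natDegree_comp_sub_pow_le g
  rw [Polynomial.natDegree_mul hs₀ hgk₀] at hle
  have := le_natDegree_of_ne_zero hcoeff₀
  omega

theorem Polynomial.Monic.exists_eq_of_comp_eq_comp {K : Type*} [Field K] [CharZero K]
    {f g h k : K[X]} (hf : f.Monic) (hg : g.Monic) (hh : h.Monic) (hk : k.Monic)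
    (hfh : f.natDegree = h.natDegree) (hgk : g.natDegree = k.natDegree) (hf₀ : f.natDegree ≠ 0)
    (hg₀ : g.natDegree ≠ 0) (heq : f.comp g = h.comp k) :
    ∃ s : K, g = k + C s ∧ f = h.comp (X - C s) := by
  have h₀ := hf.natDegree_sub_eq_zero_of_comp_eq_comp hg hh hk hfh hgk hf₀ heq
  obtain ⟨s, hs⟩ : ∃ s, C s = g - k := ⟨_, (eq_C_of_natDegree_eq_zero h₀).symm⟩
  have hg' : g = k + C s := by rw [hs]; ring
  refine ⟨s, hg', ?_⟩
  have hcomp : (f - h.comp (X - C s)).comp g = 0 := by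
    rw [sub_comp, comp_assoc, heq, hg']
    simp
  rcases comp_eq_zero_iff.1 hcomp with h1 | ⟨-, h1⟩
  · exact sub_eq_zero.1 h1
  · exact absurd (by rw [h1, natDegree_C]) hg₀

theorem compChain_monic_natDegree {f : ℕ → ℂ[X]} {d n : ℕ} (hd : d ≠ 0)
    (hmonic : ∀ j < n, (f j).Monic) (hdeg : ∀ j < n, (f j).natDegree = d) :
    (compChain f n).Monic ∧ (compChain f n).natDegree = d ^ n := by
  induction n with
  | zero => simp [compChain, monic_X]
  | succ n ih =>
    obtain ⟨hm, hn⟩ := ih (fun j hj => hmonic j (by omega)) (fun j hj => hdeg j (by omega))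
    refine ⟨(hmonic n n.lt_succ_self).comp hm (by rw [hn]; exact pow_ne_zero n hd), ?_⟩
    rw [compChain, natDegree_comp, hdeg n n.lt_succ_self, hn, pow_succ']

theorem exists_eq_dickson_of_compChain_eq {f : ℕ → ℂ[X]} {d n : ℕ} (hd : d ≠ 0)
    (hmonic : ∀ j < n, (f j).Monic) (hdeg : ∀ j < n, (f j).natDegree = d) (a b e : ℂ)
    (h : compChain f n = (dickson 1 a (d ^ n)).comp (X - C b) + C e) :
    ∃ c : ℕ → ℂ, c 0 = b ∧ c n = e ∧
      ∀ j < n, f j = (dickson 1 (a ^ d ^ j) d).comp (X - C (c j)) + C (c (j + 1)) := by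
  induction n generalizing e with
  | zero =>
    refine ⟨fun _ => b, rfl, ?_, by simp⟩
    have := congrArg (eval b) h
    simpa [compChain] using this
  | succ n ih =>
    have hdn : d ^ n ≠ 0 := pow_ne_zero n hd
    have hmonic' : ∀ j < n, (f j).Monic := fun j hj => hmonic j (by omega)
    have hdeg' : ∀ j < n, (f j).natDegree = d := fun j hj => hdeg j (by omega)
    obtain ⟨hGm, hGd⟩ := compChain_monic_natDegree hd hmonic' hdeg'
    have hDm := dickson_one_monic (a ^ d ^ n) hd
    have hDd := natDegree_dickson_one (a ^ d ^ n) hd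
    obtain ⟨s, hG, hfn⟩ := (hmonic n n.lt_succ_self).exists_eq_of_comp_eq_comp
      (h := dickson 1 (a ^ d ^ n) d + C e) (k := (dickson 1 a (d ^ n)).comp (X - C b)) hGm
      (hDm.add_of_left (degree_C_le.trans_lt (natDegree_pos_iff_degree_pos.1 (by omega))))
      ((dickson_one_monic a hdn).comp (monic_X_sub_C b) (by simp))
      (by rw [hdeg n n.lt_succ_self, natDegree_add_C, hDd])
      (by rw [hGd, natDegree_comp, natDegree_dickson_one a hdn, natDegree_X_sub_C, mul_one])
      (by rwa [hdeg n n.lt_succ_self]) (by rwa [hGd])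
      (by rw [← compChain.eq_2, h, pow_succ', dickson_one_mul, add_comp, C_comp, comp_assoc])
    obtain ⟨c, hc₀, hcn, hc⟩ := ih hmonic' hdeg' s hG
    refine ⟨Function.update c (n + 1) e, by simpa using hc₀, by simp, fun j hj => ?_⟩
    rw [Function.update_of_ne (by omega)]
    rcases Nat.lt_succ_iff_lt_or_eq.1 hj with hj | rfl
    · rw [Function.update_of_ne (by omega), hc j hj]
    · rw [Function.update_self, hcn, hfn, add_comp, C_comp]

theorem affConj_smul_chebT_eq {F : ℂ[X]} {N : ℕ} (hN : N ≠ 0) (hF : F.Monic)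
    (hFd : F.natDegree = N) {ε : ℂ} (hε : ε ^ 2 = 1) (h : AffConj F (C ε * ChebT N)) :
    ∃ a b : ℂ, a ^ (N - 1) = 1 ∧ F = (dickson 1 a N).comp (X - C b) + C b := by
  obtain ⟨u, v, hu, hFu⟩ := h
  set D := (dickson 1 (u⁻¹ ^ 2) N).comp (X - C (-v / u)) with hD
  have hF' : F = C (ε * u ^ (N - 1)) * D + C (-v / u) := by
    refine Polynomial.funext fun z => ?_
    have key := dickson_one_eval_mul u (u⁻¹ ^ 2) (z - -v / u) N
    rw [← mul_pow, mul_inv_cancel₀ hu, one_pow,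
      show u * (z - -v / u) = u * z + v by field_simp; ring] at key
    rw [hFu, hD]
    simp only [ChebT, eval_comp, eval_mul, eval_sub, eval_add, eval_C, eval_X, key]
    obtain ⟨N, rfl⟩ := Nat.exists_eq_succ_of_ne_zero hN
    rw [Nat.succ_eq_add_one, Nat.add_sub_cancel, pow_succ]
    field_simp
    ring
  have hDm : D.Monic := (dickson_one_monic _ hN).comp (monic_X_sub_C _) (by simp)
  have hDd : D.natDegree = N := by
    rw [hD, natDegree_comp, natDegree_dickson_one _ hN, natDegree_X_sub_C, mul_one]
  have hlead : ε * u ^ (N - 1) = 1 := by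
    have h1 : F.coeff N = 1 := hFd ▸ hF.coeff_natDegree
    have h2 : D.coeff N = 1 := hDd ▸ hDm.coeff_natDegree
    rwa [hF', coeff_add, coeff_C_mul, h2, coeff_C_of_ne_zero hN, mul_one, add_zero] at h1
  refine ⟨u⁻¹ ^ 2, -v / u, ?_, ?_⟩
  · have h1 : (u ^ (N - 1)) ^ 2 = 1 := by
      linear_combination (ε * u ^ (N - 1) + 1) * hlead - (u ^ (N - 1)) ^ 2 * hε
    rw [← pow_mul, mul_comm, pow_mul, inv_pow, inv_pow, h1, inv_one]
  · rw [hF', hlead, C_1, one_mul]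

/-- If `f_0, …, f_{n−1}` are monic of degree `d ≥ 2` and `f_{n−1} ∘ ⋯ ∘ f_0` is
affinely conjugate to `T_{dⁿ}` or `−T_{dⁿ}`, then there are `c_j, ℓ_j ∈ ℂ` (indices modulo `n`)
with `f_j(x) = D_d(x − c_j, ℓ_j) + c_{j+1}`, `ℓ_{j+1} = ℓ_j^d`, and `ℓ_0^(dⁿ−1) = 1`. -/
theorem stmt11 (d n : ℕ) (hd : 2 ≤ d) (hn : 1 ≤ n) (f : ℕ → Polynomial ℂ)
    (hmonic : ∀ j < n, (f j).Monic) (hdeg : ∀ j < n, (f j).natDegree = d)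
    (hconj : AffConj (compChain f n) (ChebT (d ^ n)) ∨
      AffConj (compChain f n) (-ChebT (d ^ n))) :
    ∃ c l : ℕ → ℂ,
      (∀ j < n, f j = (dickson 1 (l j) d).comp (X - C (c j)) + C (c ((j + 1) % n))) ∧
      (∀ j < n, l ((j + 1) % n) = l j ^ d) ∧
      l 0 ^ (d ^ n - 1) = 1 := by
  have hd₀ : d ≠ 0 := by omega
  obtain ⟨hm, hdn⟩ := compChain_monic_natDegree hd₀ hmonic hdeg
  have hN : d ^ n ≠ 0 := pow_ne_zero n hd₀
  obtain ⟨a, b, ha, hF⟩ : ∃ a b : ℂ, a ^ (d ^ n - 1) = 1 ∧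
      compChain f n = (dickson 1 a (d ^ n)).comp (X - C b) + C b := by
    rcases hconj with h | h
    · exact affConj_smul_chebT_eq hN hm hdn (ε := 1) (by norm_num) (by simpa using h)
    · exact affConj_smul_chebT_eq hN hm hdn (ε := -1) (by norm_num) (by simpa using h)
  obtain ⟨c, hc₀, hcn, hc⟩ := exists_eq_dickson_of_compChain_eq hd₀ hmonic hdeg a b b hF
  have han : a ^ d ^ n = a := by
    rw [← Nat.sub_one_add_one hN, pow_succ, ha, one_mul]
  refine ⟨c, fun j => a ^ d ^ j, fun j hj => ?_, fun j hj => ?_, by simpa using ha⟩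
  · rcases (Nat.succ_le_of_lt hj).lt_or_eq with h | h
    · rw [Nat.mod_eq_of_lt h, hc j hj]
    · rw [show j + 1 = n from h, Nat.mod_self, hc₀, ← hcn, ← h, hc j hj]
  · rcases (Nat.succ_le_of_lt hj).lt_or_eq with h | h
    · simp only [Nat.mod_eq_of_lt h, ← pow_mul, ← pow_succ]
    · simp only [← pow_mul, ← pow_succ]
      rw [show j + 1 = n from h, Nat.mod_self, han, pow_zero, pow_one]
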